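/- arXiv:1210.0222 — 2 statements merged into one kernel-verified Lean document; each statement's English description precedes it below -/
import Mathlib

section
/- If Y₁ and Y₂ are d×d real matrices with ‖Y₁ − I‖ < 1, ‖Y₂ − I‖ < 1 (Frobenius norm), and Y₁² = Y₂², then Y₁ = Y₂. -/
attribute [local instance] Matrix.frobeniusNormedAddCommGroup

/-- If `‖Y₁ - I‖ < 1`, `‖Y₂ - I‖ < 1` in the Frobenius norm and `Y₁² = Y₂²`,
then `Y₁ = Y₂`. -/
theorem sq_eq_sq_near_one (d : ℕ) (Y₁ Y₂ : Matrix (Fin d) (Fin d) ℝ)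
    (h1 : ‖Y₁ - 1‖ < 1) (h2 : ‖Y₂ - 1‖ < 1) (h : Y₁ ^ 2 = Y₂ ^ 2) : Y₁ = Y₂ := by
  have key : (2 : ℝ) • (Y₁ - Y₂) = -((Y₁ - 1) * (Y₁ - Y₂) + (Y₁ - Y₂) * (Y₂ - 1)) := by
    rw [two_smul]
    have h' : Y₁ * Y₁ = Y₂ * Y₂ := by simpa [pow_two] using h
    have : (Y₁ - 1) * (Y₁ - Y₂) + (Y₁ - Y₂) * (Y₂ - 1)
        = (Y₁ * Y₁ - Y₂ * Y₂) - ((Y₁ - Y₂) + (Y₁ - Y₂)) := by noncomm_ring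
    rw [this, h']
    abel
  have hn : 2 * ‖Y₁ - Y₂‖ ≤ ‖Y₁ - 1‖ * ‖Y₁ - Y₂‖ + ‖Y₁ - Y₂‖ * ‖Y₂ - 1‖ := by
    letI : NormedSpace ℝ (Matrix (Fin d) (Fin d) ℝ) := Matrix.frobeniusNormedSpace
    have e : ‖(2 : ℝ) • (Y₁ - Y₂)‖ = 2 * ‖Y₁ - Y₂‖ := by
      rw [norm_smul]; norm_num
    rw [← e, key, norm_neg]
    exact (norm_add_le _ _).trans
      (add_le_add (Matrix.frobenius_norm_mul _ _) (Matrix.frobenius_norm_mul _ _))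
  by_contra hne
  have hpos : 0 < ‖Y₁ - Y₂‖ := norm_pos_iff.mpr (sub_ne_zero.mpr hne)
  nlinarith
end

section
/- Mahler compactness criterion: a set Ω of unimodular lattices in ℝ^d is relatively compact in the space of lattices SL_d(ℤ)\SL_d(ℝ) if and only if there exists δ > 0 such that every nonzero vector of every lattice L ∈ Ω has norm at least δ. -/
open Matrix

noncomputable instance (d : ℕ) : TopologicalSpace (SpecialLinearGroup (Fin d) ℝ) :=
  TopologicalSpace.induced (fun g => (g : Matrix (Fin d) (Fin d) ℝ)) inferInstance

/-- The subgroup `SL_d(ℤ)` of `SL_d(ℝ)`. -/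
noncomputable def SLZ (d : ℕ) : Subgroup (SpecialLinearGroup (Fin d) ℝ) :=
  (SpecialLinearGroup.map (n := Fin d) (Int.castRingHom ℝ)).range

/-- The space of unimodular lattices `SL_d(ℤ)\SL_d(ℝ)` with the quotient topology. -/
abbrev LatticeSpace (d : ℕ) := Quotient (QuotientGroup.rightRel (SLZ d))


namespace Mahler

/-- integer matrix acting on a real one -/
noncomputable def act {n : ℕ} (γ : Matrix (Fin n) (Fin n) ℤ) (g : Matrix (Fin n) (Fin n) ℝ) :
    Matrix (Fin n) (Fin n) ℝ := γ.map (Int.cast : ℤ → ℝ) * g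

theorem act_apply {n : ℕ} (γ : Matrix (Fin n) (Fin n) ℤ) (g : Matrix (Fin n) (Fin n) ℝ) (i j) :
    act γ g i j = ∑ k, (γ i k : ℝ) * g k j := by
  simp [act, Matrix.mul_apply]

theorem act_act {n : ℕ} (γ γ' : Matrix (Fin n) (Fin n) ℤ) (g : Matrix (Fin n) (Fin n) ℝ) :
    act γ (act γ' g) = act (γ * γ') g := by
  unfold act
  rw [← Matrix.mul_assoc]
  congr 1
  exact (Matrix.map_mul (f := Int.castRingHom ℝ)).symm

theorem act_one {n : ℕ} (g : Matrix (Fin n) (Fin n) ℝ) : act 1 g = g := by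
  simp [act]

theorem det_act {n : ℕ} (γ : Matrix (Fin n) (Fin n) ℤ) (hγ : IsUnit γ.det)
    (g : Matrix (Fin n) (Fin n) ℝ) : |(act γ g).det| = |g.det| := by
  have h : (γ.map (Int.cast : ℤ → ℝ)).det = (γ.det : ℝ) :=
    ((Int.castRingHom ℝ).map_det γ).symm
  rw [act, Matrix.det_mul, h, abs_mul]
  rcases Int.isUnit_iff.1 hγ with h | h <;> simp [h]

/-- Schur complement -/
noncomputable def schur {n : ℕ} (G : Matrix (Fin (n+1)) (Fin (n+1)) ℝ) :
    Matrix (Fin n) (Fin n) ℝ :=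
  Matrix.of fun i j => G i.succ j.succ - G i.succ 0 / G 0 0 * G 0 j.succ

theorem det_schur {n : ℕ} (G : Matrix (Fin (n+1)) (Fin (n+1)) ℝ) (h : G 0 0 ≠ 0) :
    G.det = G 0 0 * (schur G).det := by
  let c : Fin (n+1) → ℝ := fun i => if i = 0 then 0 else G i 0 / G 0 0
  let B : Matrix (Fin (n+1)) (Fin (n+1)) ℝ := Matrix.of fun i j => G i j - c i * G 0 j
  have h1 : G.det = B.det := by
    apply Matrix.det_eq_of_forall_row_eq_smul_add_const c 0
    · simp [c]
    · intro i j
      simp [B, c]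
  rw [h1, Matrix.det_succ_column_zero, Fin.sum_univ_succ]
  have h0 : ∀ i : Fin n, B i.succ 0 = 0 := by
    intro i
    simp [B, c, Fin.succ_ne_zero]
    field_simp
    simp
  have h2 : B.submatrix (Fin.succAbove 0) Fin.succ = schur G := by
    ext i j
    simp [B, c, schur, Fin.succ_ne_zero]
  simp only [h0, h2]
  simp [B, c]

/-- extension of integer matrices -/
def ext {n : ℕ} (k : Fin n → ℤ) (γ : Matrix (Fin n) (Fin n) ℤ) :
    Matrix (Fin (n+1)) (Fin (n+1)) ℤ :=
  Matrix.of (Fin.cons (Fin.cons 1 0) (fun i => Fin.cons (k i) (γ i)))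

theorem det_ext {n : ℕ} (k : Fin n → ℤ) (γ : Matrix (Fin n) (Fin n) ℤ) :
    (ext k γ).det = γ.det := by
  rw [Matrix.det_succ_row_zero, Fin.sum_univ_succ]
  have h2 : (ext k γ).submatrix Fin.succ (Fin.succAbove 0) = γ := by
    ext i j
    simp [ext]
  rw [h2]
  simp [ext]

theorem ext_bounds {n : ℕ} (G : Matrix (Fin (n+1)) (Fin (n+1)) ℝ) (h : G 0 0 ≠ 0)
    (hr : ∀ j, |G 0 j| ≤ |G 0 0|) (γ : Matrix (Fin n) (Fin n) ℤ) :
    ∃ k : Fin n → ℤ, (∀ j, act (ext k γ) G 0 j = G 0 j) ∧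
      (∀ i : Fin n, |act (ext k γ) G i.succ 0| ≤ |G 0 0| / 2) ∧
      (∀ i j, |act (ext k γ) G i.succ j.succ| ≤ |act γ (schur G) i j| + |G 0 0| / 2) := by
  let y : Fin n → Fin (n+1) → ℝ := fun i j => ∑ l, (γ i l : ℝ) * G l.succ j
  let k : Fin n → ℤ := fun i => - round (y i 0 / G 0 0)
  have e0 : ∀ i j, act (ext k γ) G i.succ j = y i j + k i * G 0 j := by
    intro i j
    rw [act_apply, Fin.sum_univ_succ]
    simp [ext, y, add_comm]
  have e1 : ∀ i : Fin n, |act (ext k γ) G i.succ 0| ≤ |G 0 0| / 2 := by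
    intro i
    have : act (ext k γ) G i.succ 0 = (y i 0 / G 0 0 - round (y i 0 / G 0 0)) * G 0 0 := by
      rw [e0]; simp only [k]; push_cast; field_simp; ring
    rw [this, abs_mul]
    have := abs_sub_round (y i 0 / G 0 0)
    nlinarith [abs_nonneg (G 0 0)]
  refine ⟨k, ?_, e1, ?_⟩
  · intro j
    rw [act_apply, Fin.sum_univ_succ]
    simp [ext]
  · intro i j
    have h3 : act γ (schur G) i j = y i j.succ - y i 0 / G 0 0 * G 0 j.succ := by
      rw [act_apply]
      simp only [schur, y, Matrix.of_apply, Finset.sum_div, Finset.sum_mul,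
        ← Finset.sum_sub_distrib]
      refine Finset.sum_congr rfl fun l _ => ?_
      ring
    have h4 : act (ext k γ) G i.succ j.succ = act γ (schur G) i j +
        act (ext k γ) G i.succ 0 * (G 0 j.succ / G 0 0) := by
      rw [h3, e0, e0]; field_simp; ring
    have h5 : |G 0 j.succ / G 0 0| ≤ 1 := by
      rw [abs_div]
      exact div_le_one_of_le₀ (hr _) (abs_nonneg _)
    rw [h4]
    refine (abs_add_le _ _).trans ?_
    rw [abs_mul]
    have := e1 i
    nlinarith [abs_nonneg (act (ext k γ) G i.succ 0), abs_nonneg (G 0 j.succ / G 0 0)]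

def P (n : ℕ) : Prop := ∀ δ : ℝ, 0 < δ → ∀ D : ℝ, ∃ C : ℝ, ∀ g : Matrix (Fin n) (Fin n) ℝ,
  |g.det| ≤ D → (∀ γ : Matrix (Fin n) (Fin n) ℤ, IsUnit γ.det → ∀ i, δ ≤ ‖act γ g i‖) →
  ∃ γ : Matrix (Fin n) (Fin n) ℤ, IsUnit γ.det ∧ ∀ i j, |act γ g i j| ≤ C

theorem core {n : ℕ} (hP : P n) (δ : ℝ) (hδ : 0 < δ) (D : ℝ) : ∃ C : ℝ,
    ∀ G : Matrix (Fin (n+1)) (Fin (n+1)) ℝ, |G.det| ≤ D → δ ≤ |G 0 0| →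
    (∀ j, |G 0 j| ≤ |G 0 0|) →
    (∀ γ : Matrix (Fin (n+1)) (Fin (n+1)) ℤ, IsUnit γ.det →
      ∀ i, |G 0 0| ≤ 3 / 2 * ‖act γ G i‖) →
    ∃ γ : Matrix (Fin (n+1)) (Fin (n+1)) ℤ, IsUnit γ.det ∧ ∀ i j, |act γ G i j| ≤ C := by
  obtain ⟨C, hC⟩ := hP (δ / 6) (by positivity) (D / δ)
  refine ⟨7 * |C| + |D|, fun G hD ha hr hmin => ?_⟩
  have h0 : G 0 0 ≠ 0 := by
    intro h; rw [h, abs_zero] at ha; linarith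
  have hdet := det_schur G h0
  have hs : ∀ γ : Matrix (Fin n) (Fin n) ℤ, IsUnit γ.det → ∀ i,
      |G 0 0| / 6 ≤ ‖act γ (schur G) i‖ := by
    intro γ hγ i
    obtain ⟨k, -, k1, k2⟩ := ext_bounds G h0 hr γ
    have h1 := hmin (ext k γ) (by rwa [det_ext]) i.succ
    have h2 : ‖act (ext k γ) G i.succ‖ ≤ ‖act γ (schur G) i‖ + |G 0 0| / 2 := by
      rw [pi_norm_le_iff_of_nonneg (by positivity)]
      intro j
      rw [Real.norm_eq_abs]
      refine Fin.cases ?_ (fun j => ?_) j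
      · have := k1 i
        have := norm_nonneg (act γ (schur G) i)
        linarith
      · have := k2 i j
        have := norm_le_pi_norm (act γ (schur G) i) j
        rw [Real.norm_eq_abs] at this
        linarith
    linarith
  have hd' : |(schur G).det| ≤ D / δ := by
    rw [le_div_iff₀ hδ]
    rw [hdet, abs_mul] at hD
    nlinarith [abs_nonneg (schur G).det]
  obtain ⟨γ, hγ, hb⟩ := hC (schur G) hd' (fun γ hγ i => by linarith [hs γ hγ i])
  have hC0 := le_abs_self C
  have hC1 := abs_nonneg C
  have hD0 := le_abs_self D
  have hD1 := abs_nonneg D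
  have haC : |G 0 0| ≤ 6 * |C| + |D| := by
    rcases n with _ | n
    · rw [hdet] at hD
      simp at hD
      linarith
    · have h1 := hs γ hγ 0
      have h2 : ‖act γ (schur G) 0‖ ≤ |C| := by
        rw [pi_norm_le_iff_of_nonneg (abs_nonneg _)]
        intro j
        exact (hb 0 j).trans hC0
      linarith
  obtain ⟨k, k0, k1, k2⟩ := ext_bounds G h0 hr γ
  refine ⟨ext k γ, by rwa [det_ext], fun i j => ?_⟩
  refine Fin.cases ?_ (fun i => ?_) i
  · rw [k0]
    linarith [hr j]
  · refine Fin.cases ?_ (fun j => ?_) j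
    · linarith [k1 i]
    · linarith [k2 i j, hb i j]

theorem act_submatrix {n : ℕ} (γ : Matrix (Fin n) (Fin n) ℤ) (g : Matrix (Fin n) (Fin n) ℝ)
    (σ : Equiv.Perm (Fin n)) (i j) : act γ (g.submatrix id σ) i j = act γ g i (σ j) := by
  simp [act_apply]

theorem norm_comp_perm {n : ℕ} (f : Fin n → ℝ) (σ : Equiv.Perm (Fin n)) :
    ‖fun j => f (σ j)‖ = ‖f‖ := by
  apply le_antisymm
  · rw [pi_norm_le_iff_of_nonneg (norm_nonneg _)]
    exact fun j => norm_le_pi_norm f _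
  · rw [pi_norm_le_iff_of_nonneg (norm_nonneg _)]
    intro j
    simpa using norm_le_pi_norm (fun j => f (σ j)) (σ.symm j)

theorem norm_attained {n : ℕ} (f : Fin (n+1) → ℝ) : ∃ j, |f j| = ‖f‖ := by
  obtain ⟨j, hj⟩ := Finite.exists_max (fun j => |f j|)
  refine ⟨j, le_antisymm (norm_le_pi_norm f j) ?_⟩
  rw [pi_norm_le_iff_of_nonneg (abs_nonneg _)]
  exact hj

theorem P_all (n : ℕ) : P n := by
  induction n with
  | zero =>
    intro δ _ D
    exact ⟨0, fun g _ _ => ⟨1, by simp, fun i => i.elim0⟩⟩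
  | succ n ih =>
    intro δ hδ D
    obtain ⟨C, hC⟩ := core ih δ hδ D
    refine ⟨C, fun g hD hg => ?_⟩
    let S : Set ℝ := {r | ∃ γ : Matrix (Fin (n+1)) (Fin (n+1)) ℤ, IsUnit γ.det ∧
      ∃ i, r = ‖act γ g i‖}
    have hSne : S.Nonempty := ⟨_, 1, by simp, 0, rfl⟩
    have hSb : ∀ r ∈ S, δ ≤ r := by
      rintro r ⟨γ, hγ, i, rfl⟩
      exact hg γ hγ i
    have hI : δ ≤ sInf S := le_csInf hSne hSb
    obtain ⟨r, ⟨γ, hγ, i, hr⟩, hlt⟩ :=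
      exists_lt_of_csInf_lt hSne (show sInf S < 3 / 2 * sInf S by linarith)
    have hmin : ∀ γ' : Matrix (Fin (n+1)) (Fin (n+1)) ℤ, IsUnit γ'.det → ∀ i',
        ‖act γ g i‖ ≤ 3 / 2 * ‖act γ' g i'‖ := by
      intro γ' hγ' i'
      have : sInf S ≤ ‖act γ' g i'‖ := csInf_le ⟨δ, hSb⟩ ⟨γ', hγ', i', rfl⟩
      linarith
    obtain ⟨j, hj⟩ := norm_attained (act γ g i)
    let τ := Equiv.swap 0 i
    let σ := Equiv.swap 0 j
    let γ1 : Matrix (Fin (n+1)) (Fin (n+1)) ℤ := γ.submatrix τ id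
    have hγ1 : IsUnit γ1.det := by
      simp only [γ1]
      rw [Matrix.det_permute]
      exact ((Equiv.Perm.sign τ).isUnit).mul hγ
    have hrow : ∀ l, act γ1 g 0 l = act γ g i l := by
      intro l
      simp [act_apply, γ1, τ]
    let G := act γ1 (g.submatrix id σ)
    have hG : ∀ γ' i' j', act γ' G i' j' = act (γ' * γ1) g i' (σ j') := by
      intro γ' i' j'
      rw [act_act, act_submatrix]
    have hG00 : |G 0 0| = ‖act γ g i‖ := by
      rw [← hj]
      simp only [G]
      rw [act_submatrix, hrow]
      simp [σ]
    have hr1 := hg γ hγ i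
    have g1 : |G.det| ≤ D := by
      simp only [G]
      rw [det_act _ hγ1, Matrix.det_permute', abs_mul]
      rcases Int.units_eq_one_or (Equiv.Perm.sign σ) with h | h <;> simpa [h] using hD
    have g2 : ∀ l, |G 0 l| ≤ |G 0 0| := by
      intro l
      rw [hG00]
      simp only [G]
      rw [act_submatrix, hrow]
      exact norm_le_pi_norm (act γ g i) _
    have g3 : ∀ γ' : Matrix (Fin (n+1)) (Fin (n+1)) ℤ, IsUnit γ'.det → ∀ i',
        |G 0 0| ≤ 3 / 2 * ‖act γ' G i'‖ := by
      intro γ' hγ' i'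
      have : ‖act γ' G i'‖ = ‖act (γ' * γ1) g i'‖ := by
        rw [← norm_comp_perm (act (γ' * γ1) g i') σ]
        congr 1
        funext l
        exact hG _ _ _
      rw [hG00, this]
      exact hmin _ (by rw [Matrix.det_mul]; exact hγ'.mul hγ1) _
    obtain ⟨γ2, hγ2, hb⟩ := hC G g1 (by rwa [hG00]) g2 g3
    refine ⟨γ2 * γ1, by rw [Matrix.det_mul]; exact hγ2.mul hγ1, fun i' j' => ?_⟩
    have := hb i' (σ.symm j')
    rw [hG] at this
    simpa using this


theorem reduce (d : ℕ) (δ : ℝ) (hδ : 0 < δ) : ∃ C : ℝ,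
    ∀ g : SpecialLinearGroup (Fin d) ℝ,
      (∀ m : Fin d → ℤ, m ≠ 0 →
        δ ≤ ‖Matrix.vecMul (fun i => (m i : ℝ)) (g : Matrix (Fin d) (Fin d) ℝ)‖) →
      ∃ γ ∈ SLZ d, ∀ i j, |((γ * g : SpecialLinearGroup (Fin d) ℝ) :
        Matrix (Fin d) (Fin d) ℝ) i j| ≤ C := by
  obtain ⟨C, hC⟩ := P_all d δ hδ 1
  refine ⟨C, fun g hg => ?_⟩
  have hdg : (g : Matrix (Fin d) (Fin d) ℝ).det = 1 := g.2
  obtain ⟨γ, hγ, hb⟩ := hC (g : Matrix (Fin d) (Fin d) ℝ) (by rw [hdg]; simp) (by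
    intro γ hγ i
    refine hg (γ i) ?_
    intro h0
    rw [Matrix.det_eq_zero_of_row_eq_zero i (fun j => congrFun h0 j)] at hγ
    simp at hγ)
  have key : ∃ γ : Matrix (Fin d) (Fin d) ℤ, γ.det = 1 ∧
      ∀ i j, |act γ (g : Matrix (Fin d) (Fin d) ℝ) i j| ≤ C := by
    rcases Int.isUnit_iff.1 hγ with h | h
    · exact ⟨γ, h, hb⟩
    · rcases d with _ | d
      · simp at h
      · refine ⟨γ.updateRow 0 ((-1 : ℤ) • γ 0), ?_, ?_⟩
        · rw [Matrix.det_updateRow_smul, Matrix.updateRow_eq_self, h]; simp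
        · intro i j
          have := hb i j
          rw [act_apply] at this ⊢
          by_cases hi : i = 0
          · subst hi
            simpa [Finset.sum_neg_distrib] using this
          · simpa [Matrix.updateRow_ne hi] using this
  obtain ⟨γ, hγ1, hb⟩ := key
  refine ⟨SpecialLinearGroup.map (Int.castRingHom ℝ) ⟨γ, hγ1⟩, ⟨⟨γ, hγ1⟩, rfl⟩, ?_⟩
  intro i j
  exact hb i j

theorem isOpenMap_mk (d : ℕ) : IsOpenMap
    (Quotient.mk (QuotientGroup.rightRel (SLZ d)) : SpecialLinearGroup (Fin d) ℝ → LatticeSpace d) :=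
  haveI : IsTopologicalGroup (SpecialLinearGroup (Fin d) ℝ) :=
    SpecialLinearGroup.topologicalGroup
  isOpenMap_quotient_mk'_mul (Γ := SLZ d) (T := SpecialLinearGroup (Fin d) ℝ)

theorem isClosedEmbedding_coe (d : ℕ) : Topology.IsClosedEmbedding
    (fun g : SpecialLinearGroup (Fin d) ℝ => (g : Matrix (Fin d) (Fin d) ℝ)) :=
  SpecialLinearGroup.isClosedEmbedding_val

/-- Invariance of the shortness condition. -/
theorem invariant {d : ℕ} {δ : ℝ} {g h : SpecialLinearGroup (Fin d) ℝ}
    (hgh : (Quotient.mk (QuotientGroup.rightRel (SLZ d)) g) = Quotient.mk _ h)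
    (hg : ∀ m : Fin d → ℤ, m ≠ 0 →
        δ ≤ ‖Matrix.vecMul (fun i => (m i : ℝ)) (g : Matrix (Fin d) (Fin d) ℝ)‖) :
    ∀ m : Fin d → ℤ, m ≠ 0 →
        δ ≤ ‖Matrix.vecMul (fun i => (m i : ℝ)) (h : Matrix (Fin d) (Fin d) ℝ)‖ := by
  intro m hm
  have h1 := QuotientGroup.rightRel_apply.1 (Quotient.exact hgh)
  obtain ⟨γ, hγ⟩ := h1
  have h2 : h = SpecialLinearGroup.map (Int.castRingHom ℝ) γ * g := by
    rw [hγ]; simp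
  have h3 := hg (Matrix.vecMul m (γ : Matrix (Fin d) (Fin d) ℤ)) (by
    intro h0
    apply hm
    have : Matrix.vecMul (Matrix.vecMul m (γ : Matrix (Fin d) (Fin d) ℤ))
      ((γ⁻¹ : SpecialLinearGroup (Fin d) ℤ) : Matrix (Fin d) (Fin d) ℤ) = m := by
      have e : (γ : Matrix (Fin d) (Fin d) ℤ) *
          ((γ⁻¹ : SpecialLinearGroup (Fin d) ℤ) : Matrix (Fin d) (Fin d) ℤ) = 1 :=
        congrArg Subtype.val (mul_inv_cancel γ)
      rw [Matrix.vecMul_vecMul, e, Matrix.vecMul_one]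
    rw [← this, h0, Matrix.zero_vecMul])
  convert h3 using 2
  have e : (h : Matrix (Fin d) (Fin d) ℝ) =
      (γ : Matrix (Fin d) (Fin d) ℤ).map (Int.cast : ℤ → ℝ) * (g : Matrix (Fin d) (Fin d) ℝ) :=
    congrArg Subtype.val h2
  rw [e, ← Matrix.vecMul_vecMul]
  congr 1
  funext i
  simp [Matrix.vecMul, dotProduct]

theorem lower {d : ℕ} {N : ℝ} (hN : 0 < N) {h : SpecialLinearGroup (Fin d) ℝ}
    (hh : ∀ i j, |(h : Matrix (Fin d) (Fin d) ℝ).adjugate i j| < N) (m : Fin d → ℤ) (hm : m ≠ 0) :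
    1 / ((d + 1) * N) ≤ ‖Matrix.vecMul (fun i => (m i : ℝ)) (h : Matrix (Fin d) (Fin d) ℝ)‖ := by
  set v := Matrix.vecMul (fun i => (m i : ℝ)) (h : Matrix (Fin d) (Fin d) ℝ) with hv
  have h1 : Matrix.vecMul v (h : Matrix (Fin d) (Fin d) ℝ).adjugate = fun i => (m i : ℝ) := by
    rw [hv, Matrix.vecMul_vecMul, Matrix.mul_adjugate, h.2]
    simp
  obtain ⟨i, hi⟩ := Function.ne_iff.1 hm
  have h2 : (1 : ℝ) ≤ |(m i : ℝ)| := by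
    have := Int.one_le_abs hi
    exact_mod_cast this
  rw [← congrFun h1 i] at h2
  have h3 : |Matrix.vecMul v (h : Matrix (Fin d) (Fin d) ℝ).adjugate i| ≤ d * (‖v‖ * N) := by
    simp only [Matrix.vecMul, dotProduct]
    refine (Finset.abs_sum_le_sum_abs _ _).trans ?_
    refine (Finset.sum_le_card_nsmul _ _ (‖v‖ * N) ?_).trans (by simp)
    intro j _
    rw [abs_mul]
    exact mul_le_mul (norm_le_pi_norm v j) (hh j i).le (abs_nonneg _) (norm_nonneg _)
  rw [div_le_iff₀ (by positivity)]
  nlinarith [norm_nonneg v, mul_nonneg (norm_nonneg v) hN.le]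

end Mahler

/-- Mahler compactness criterion: a set `Ω` of unimodular lattices, viewed as a subset of
`SL_d(ℤ)\SL_d(ℝ)`, is relatively compact iff there is `δ > 0` such that every nonzero
vector of every lattice in `Ω` has norm at least `δ`.  The lattice corresponding to
`g ∈ SL_d(ℝ)` is `ℤ^d · g = {m ⬝ g : m ∈ ℤ^d}`. -/
theorem mahler_compactness (d : ℕ) (Ω : Set (LatticeSpace d)) :
    IsCompact (closure Ω) ↔
      ∃ δ : ℝ, 0 < δ ∧
        ∀ g : SpecialLinearGroup (Fin d) ℝ,
          (Quotient.mk (QuotientGroup.rightRel (SLZ d)) g) ∈ Ω →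
            ∀ m : Fin d → ℤ, m ≠ 0 →
              δ ≤ ‖Matrix.vecMul (fun i => (m i : ℝ)) (g : Matrix (Fin d) (Fin d) ℝ)‖ := by
  have hcont : Continuous (fun g : SpecialLinearGroup (Fin d) ℝ =>
    (g : Matrix (Fin d) (Fin d) ℝ)) := (Mahler.isClosedEmbedding_coe d).continuous
  constructor
  · intro hK
    let W : ℕ → Set (SpecialLinearGroup (Fin d) ℝ) := fun n =>
      {h | ∀ i j, |(h : Matrix (Fin d) (Fin d) ℝ).adjugate i j| < n + 1}
    have hW : ∀ n, IsOpen (W n) := by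
      intro n
      simp only [W, Set.ofPred_forall]
      refine isOpen_iInter_of_finite fun i => isOpen_iInter_of_finite fun j => ?_
      exact isOpen_lt ((hcont.matrix_adjugate.matrix_elem i j).abs) continuous_const
    have hmono : Monotone W := by
      intro a b hab h hh i j
      have : (a : ℝ) ≤ b := by exact_mod_cast hab
      linarith [hh i j]
    obtain ⟨n, hn⟩ := hK.elim_directed_cover
      (fun n => Quotient.mk (QuotientGroup.rightRel (SLZ d)) '' W n)
      (fun n => Mahler.isOpenMap_mk d _ (hW n))
      (by
        intro x _
        induction x using Quotient.inductionOn with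
        | h g =>
          obtain ⟨n, hn⟩ := exists_nat_gt
            (∑ i, ∑ j, |(g : Matrix (Fin d) (Fin d) ℝ).adjugate i j|)
          refine Set.mem_iUnion.2 ⟨n, g, fun i j => ?_, rfl⟩
          have h1 := Finset.single_le_sum
            (f := fun j => |(g : Matrix (Fin d) (Fin d) ℝ).adjugate i j|)
            (fun j _ => abs_nonneg _) (Finset.mem_univ j)
          have h2 := Finset.single_le_sum
            (f := fun i => ∑ j, |(g : Matrix (Fin d) (Fin d) ℝ).adjugate i j|)
            (fun i _ => Finset.sum_nonneg fun j _ => abs_nonneg _) (Finset.mem_univ i)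
          change |(g : Matrix (Fin d) (Fin d) ℝ).adjugate i j| < n + 1
          linarith)
      (Monotone.directed_le fun a b hab => Set.image_mono (hmono hab))
    refine ⟨1 / ((d + 1) * (n + 1)), by positivity, fun g hg => ?_⟩
    obtain ⟨h, hh, hgh⟩ := hn (subset_closure hg)
    exact Mahler.invariant hgh (Mahler.lower (by positivity) hh)
  · rintro ⟨δ, hδ, hΩ⟩
    obtain ⟨C, hC⟩ := Mahler.reduce d δ hδ
    let F : Set (SpecialLinearGroup (Fin d) ℝ) := {g | ∀ m : Fin d → ℤ, m ≠ 0 →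
      δ ≤ ‖Matrix.vecMul (fun i => (m i : ℝ)) (g : Matrix (Fin d) (Fin d) ℝ)‖}
    have hF : IsClosed F := by
      simp only [F, Set.ofPred_forall]
      refine isClosed_iInter fun m => isClosed_iInter fun _ => ?_
      exact isClosed_le continuous_const (continuous_const.matrix_vecMul hcont).norm
    let Q : Set (LatticeSpace d) := Quotient.mk (QuotientGroup.rightRel (SLZ d)) '' F
    have hpre : Quotient.mk (QuotientGroup.rightRel (SLZ d)) ⁻¹' Q = F := by
      apply Set.Subset.antisymm
      · rintro g ⟨h, hh, hgh⟩
        exact Mahler.invariant hgh hh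
      · exact Set.subset_preimage_image _ _
    have hQ : IsClosed Q := by
      refine (isQuotientMap_quotient_mk'.isClosed_preimage).1 ?_
      exact hpre ▸ hF
    let K : Set (SpecialLinearGroup (Fin d) ℝ) :=
      {g | ∀ i j, |(g : Matrix (Fin d) (Fin d) ℝ) i j| ≤ C}
    have hK : IsCompact K := by
      have h1 : IsCompact (Set.univ.pi fun _ : Fin d => Set.univ.pi fun _ : Fin d =>
          Set.Icc (-C) C) := isCompact_univ_pi fun _ => isCompact_univ_pi fun _ => isCompact_Icc
      have h2 := (Mahler.isClosedEmbedding_coe d).isCompact_preimage h1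
      convert h2 using 1
      ext g
      constructor
      · exact fun hg i _ j _ => abs_le.1 (hg i j)
      · exact fun hg i j => abs_le.2 (hg i trivial j trivial)
    have hsub : closure Ω ⊆ Quotient.mk (QuotientGroup.rightRel (SLZ d)) '' K := by
      refine (closure_minimal (t := Q) ?_ hQ).trans ?_
      · intro x hx
        induction x using Quotient.inductionOn with
        | h g => exact ⟨g, hΩ g hx, rfl⟩
      · rintro _ ⟨g, hg, rfl⟩
        obtain ⟨γ, hγ, hb⟩ := hC g hg
        refine ⟨γ * g, hb, Quotient.sound ?_⟩
        apply QuotientGroup.rightRel_apply.2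
        simpa using hγ
    exact (hK.image continuous_quotient_mk').of_isClosed_subset isClosed_closure hsub
end
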